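/- Mono-static closed-loop inner bound: Under the standing assumption, for every |𝒮|-tuple (P_{X,s})_{s∈𝒮} of probability distributions on 𝒳, every pair (R,E) ∈ ℝ₊² with R ≤ min_{s∈𝒮} I(P_{X,s}, W_{Y|X,s}) and E ≤ min_{s∈𝒮} φ(P_{X,s}) belongs to the closure C_closed of the set of closed-loop achievable rate/detection-error-exponent pairs in the mono-static joint communication and sensing model. -/

import Mathlib

open scoped BigOperators ENNReal NNReal

namespace JCAS

variable {𝒳 𝒴 𝒵 𝒮 : Type}

/-- `p` is a probability mass function on the finite alphabet `𝒳`. -/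
def IsPMF [Fintype 𝒳] (p : 𝒳 → ℝ) : Prop :=
  (∀ x, 0 ≤ p x) ∧ ∑ x, p x = 1

/-- `V` is a channel (conditional probability distribution) from `𝒳` to `𝒴`. -/
def IsChannel [Fintype 𝒳] [Fintype 𝒴] (V : 𝒳 → 𝒴 → ℝ) : Prop :=
  ∀ x, IsPMF (V x)

/-- Mutual information `I(P, V)` (natural logarithm), with `0·log(0/a) = 0`. -/
noncomputable def mutualInfo [Fintype 𝒳] [Fintype 𝒴] (P : 𝒳 → ℝ) (V : 𝒳 → 𝒴 → ℝ) : ℝ :=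
  ∑ x, ∑ y, P x * V x y * Real.log (V x y / ∑ x', P x' * V x' y)

/-- `a ^ ℓ` with the convention `0 ^ ℓ = 0` (in particular `0 ^ 0 = 0`). -/
noncomputable def pow0 (a ℓ : ℝ) : ℝ := if a = 0 then 0 else a ^ ℓ

/-- `Σ_z W(z)^ℓ · W'(z)^{1-ℓ}`. -/
noncomputable def chernoffSum [Fintype 𝒵] (W W' : 𝒵 → ℝ) (ℓ : ℝ) : ℝ :=
  ∑ z, pow0 (W z) ℓ * pow0 (W' z) (1 - ℓ)

/-- Chernoff information between the channels `W` and `W'` under input distribution `P`: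
`max_{ℓ∈[0,1]} −Σ_x P(x) log( Σ_z W(z|x)^ℓ W'(z|x)^{1−ℓ} )`. -/
noncomputable def chernoffPair [Fintype 𝒳] [Fintype 𝒵] (P : 𝒳 → ℝ) (W W' : 𝒳 → 𝒵 → ℝ) : ℝ :=
  sSup ((fun ℓ => -∑ x, P x * Real.log (chernoffSum (W x) (W' x) ℓ)) '' Set.Icc (0 : ℝ) 1)

/-- `ψ_s(P) = min_{s' ≠ s} (Chernoff information between `W_s` and `W_{s'}` under `P`)`. -/
noncomputable def psi [Fintype 𝒳] [Fintype 𝒵] (WZ : 𝒮 → 𝒳 → 𝒵 → ℝ) (P : 𝒳 → ℝ) (s : 𝒮) : ℝ :=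
  sInf ((fun s' => chernoffPair P (WZ s) (WZ s')) '' {s' : 𝒮 | s' ≠ s})

/-- Chernoff detection-error exponent `φ(P) = min_s ψ_s(P)`. -/
noncomputable def phi [Fintype 𝒳] [Fintype 𝒵] (WZ : 𝒮 → 𝒳 → 𝒵 → ℝ) (P : 𝒳 → ℝ) : ℝ :=
  ⨅ s, psi WZ P s

/-- Standing assumption: for all `s ≠ s'` the best Chernoff information is positive. -/
def StandingAssumption [Fintype 𝒳] [Fintype 𝒵] (WZ : 𝒮 → 𝒳 → 𝒵 → ℝ) : Prop :=
  ∀ s s' : 𝒮, s ≠ s' →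
    0 < sSup ((fun P => chernoffPair P (WZ s) (WZ s')) '' {P : 𝒳 → ℝ | IsPMF P})

/-- Empirical distribution (type) of a sequence `x ∈ 𝒳ⁿ`. -/
noncomputable def empDist [Fintype 𝒳] [DecidableEq 𝒳] {n : ℕ} (x : Fin n → 𝒳) (a : 𝒳) : ℝ :=
  (Finset.univ.filter (fun i => x i = a)).card / n

/-- Marginal channel to `𝒴` of a mono-static channel `W_{YZ|X,S}`. -/
noncomputable def margY [Fintype 𝒵] (W : 𝒳 → 𝒮 → 𝒴 × 𝒵 → ℝ) (s : 𝒮) (x : 𝒳) (y : 𝒴) : ℝ :=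
  ∑ z, W x s (y, z)

/-- Marginal channel to `𝒵` of a mono-static channel `W_{YZ|X,S}`. -/
noncomputable def margZ [Fintype 𝒴] (W : 𝒳 → 𝒮 → 𝒴 × 𝒵 → ℝ) (s : 𝒮) (x : 𝒳) (z : 𝒵) : ℝ :=
  ∑ y, W x s (y, z)

open Classical in
/-- Probability of an event `A` on `(Yⁿ, Zⁿ)` when the codeword `x` is sent over the
mono-static channel in state `s` (coordinates i.i.d. given inputs). -/
noncomputable def probEvent [Fintype 𝒴] [Fintype 𝒵] {n : ℕ} (W : 𝒳 → 𝒮 → 𝒴 × 𝒵 → ℝ)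
    (x : Fin n → 𝒳) (s : 𝒮) (A : (Fin n → 𝒴 × 𝒵) → Prop) : ℝ :=
  ∑ yz : Fin n → 𝒴 × 𝒵, if A yz then ∏ i, W (x i) s (yz i) else 0

/-- `(R, E)` is an open-loop achievable rate / detection-error-exponent pair for
the mono-static model. -/
def OpenLoopAchievable [Fintype 𝒳] [Fintype 𝒴] [Fintype 𝒵] (W : 𝒳 → 𝒮 → 𝒴 × 𝒵 → ℝ)
    (R E : ℝ) : Prop :=
  ∀ ε > (0 : ℝ), ∃ (n M : ℕ) (f : Fin M → Fin n → 𝒳)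
      (g : (Fin n → 𝒳) → (Fin n → 𝒵) → 𝒮) (h : (Fin n → 𝒴) → Fin M),
    0 < n ∧ 0 < M ∧
    R - ε ≤ Real.log M / n ∧
    (∀ (s : 𝒮) (w : Fin M),
      probEvent W (f w) s (fun yz => h (fun i => (yz i).1) ≠ w) ≤ ε) ∧
    (∀ (s : 𝒮) (w : Fin M),
      probEvent W (f w) s (fun yz => g (f w) (fun i => (yz i).2) ≠ s)
        ≤ Real.exp (-(n : ℝ) * (E - ε)))

/-- `C_open`: closure of the set of open-loop achievable pairs in `ℝ₊²`. -/
def Copen [Fintype 𝒳] [Fintype 𝒴] [Fintype 𝒵] (W : 𝒳 → 𝒮 → 𝒴 × 𝒵 → ℝ) : Set (ℝ × ℝ) :=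
  closure {p : ℝ × ℝ | 0 ≤ p.1 ∧ 0 ≤ p.2 ∧ OpenLoopAchievable W p.1 p.2}

/-- Codeword realized by a closed-loop (strictly causal feedback) encoder on feedback `yz`. -/
def xReal {n : ℕ} (enc : (i : Fin n) → (Fin i.val → 𝒵) → 𝒳)
    (yz : Fin n → 𝒴 × 𝒵) (i : Fin n) : 𝒳 :=
  enc i (fun j => (yz ⟨j.1, j.2.trans i.2⟩).2)

open Classical in
/-- Probability of an event `A` on `(Yⁿ, Zⁿ)` under a closed-loop encoder in state `s`. -/
noncomputable def clProbEvent [Fintype 𝒴] [Fintype 𝒵] {n : ℕ} (W : 𝒳 → 𝒮 → 𝒴 × 𝒵 → ℝ)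
    (enc : (i : Fin n) → (Fin i.val → 𝒵) → 𝒳) (s : 𝒮)
    (A : (Fin n → 𝒴 × 𝒵) → Prop) : ℝ :=
  ∑ yz : Fin n → 𝒴 × 𝒵, if A yz then ∏ i, W (xReal enc yz i) s (yz i) else 0

/-- `(R, E)` is a closed-loop achievable rate / detection-error-exponent pair for
the mono-static model. -/
def ClosedLoopAchievable [Fintype 𝒳] [Fintype 𝒴] [Fintype 𝒵] (W : 𝒳 → 𝒮 → 𝒴 × 𝒵 → ℝ)
    (R E : ℝ) : Prop :=
  ∀ ε > (0 : ℝ), ∃ (n M : ℕ)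
      (f : Fin M → (i : Fin n) → (Fin i.val → 𝒵) → 𝒳)
      (g : (Fin n → 𝒳) → (Fin n → 𝒵) → 𝒮) (h : (Fin n → 𝒴) → Fin M),
    0 < n ∧ 0 < M ∧
    R - ε ≤ Real.log M / n ∧
    (∀ (s : 𝒮) (w : Fin M),
      clProbEvent W (f w) s (fun yz => h (fun i => (yz i).1) ≠ w) ≤ ε) ∧
    (∀ (s : 𝒮) (w : Fin M),
      clProbEvent W (f w) s (fun yz => g (xReal (f w) yz) (fun i => (yz i).2) ≠ s)
        ≤ Real.exp (-(n : ℝ) * (E - ε)))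

section Indicator

open Classical in
/-- Real-valued indicator of a proposition. -/
noncomputable def ind (A : Prop) : ℝ := if A then 1 else 0

lemma ite_eq_ind_mul (A : Prop) [Decidable A] (q : ℝ) :
    (if A then q else 0) = ind A * q := by
  unfold ind
  by_cases h : A <;> simp [h]

lemma ind_of {A : Prop} (h : A) : ind A = 1 := by simp [ind, h]

lemma ind_of_not {A : Prop} (h : ¬ A) : ind A = 0 := by simp [ind, h]

lemma ind_nonneg (A : Prop) : 0 ≤ ind A := by
  by_cases h : A <;> simp [ind, h]

lemma ind_le_one (A : Prop) : ind A ≤ 1 := by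
  by_cases h : A <;> simp [ind, h]

lemma ind_le_of_imp {A : Prop} {c : ℝ} (hc : 0 ≤ c) (h : A → 1 ≤ c) : ind A ≤ c := by
  by_cases hA : A
  · rw [ind_of hA]; exact h hA
  · rw [ind_of_not hA]; exact hc

lemma ind_mono {A B : Prop} (h : A → B) : ind A ≤ ind B :=
  ind_le_of_imp (ind_nonneg B) fun hA => (ind_of (h hA)).ge

lemma ind_exists_le {κ : Type*} [Fintype κ] (A : κ → Prop) : ind (∃ k, A k) ≤ ∑ k, ind (A k) := by
  refine ind_le_of_imp (Finset.sum_nonneg fun k _ => ind_nonneg _) ?_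
  rintro ⟨k, hk⟩
  rw [← ind_of hk]
  exact Finset.single_le_sum (f := fun k => ind (A k)) (fun k _ => ind_nonneg _) (Finset.mem_univ k)

end Indicator

section ProductDistributions

variable {ι α : Type} [Fintype ι] [DecidableEq ι] [Fintype α]

lemma sum_pi_prod (g : ι → α → ℝ) :
    ∑ u : ι → α, ∏ i, g i (u i) = ∏ i, ∑ a, g i a := by
  rw [Finset.prod_univ_sum, Fintype.piFinset_univ]

lemma IsPMF.pi {p : ι → α → ℝ} (hp : ∀ i, IsPMF (p i)) :
    IsPMF (fun u : ι → α => ∏ i, p i (u i)) :=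
  ⟨fun _ => Finset.prod_nonneg fun i _ => (hp i).1 _, by
    rw [sum_pi_prod]; exact Finset.prod_eq_one fun i _ => (hp i).2⟩

lemma sum_pi_marginal {p : ι → α → ℝ} (hp : ∀ i, IsPMF (p i)) (j : ι) (g : α → ℝ) :
    ∑ u : ι → α, (∏ i, p i (u i)) * g (u j) = ∑ a, p j a * g a := by
  classical
  have h1 : ∀ u : ι → α, (∏ i, p i (u i)) * g (u j)
      = ∏ i, p i (u i) * (if i = j then g (u i) else 1) := fun u => by
    rw [Finset.prod_mul_distrib]; simp
  simp_rw [h1]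
  rw [sum_pi_prod (fun i a => p i a * (if i = j then g a else 1)), Finset.prod_eq_single j]
  · simp
  · intro i _ hij
    simp [hij, (hp i).2]
  · simp

lemma sum_pi_marginal_mul {p : ι → α → ℝ} (hp : ∀ i, IsPMF (p i)) {j k : ι} (hjk : j ≠ k)
    (g h : α → ℝ) :
    ∑ u : ι → α, (∏ i, p i (u i)) * (g (u j) * h (u k))
      = (∑ a, p j a * g a) * ∑ a, p k a * h a := by
  classical
  have h1 : ∀ u : ι → α, (∏ i, p i (u i)) * (g (u j) * h (u k))
      = ∏ i, p i (u i) * ((if i = j then g (u i) else 1) * (if i = k then h (u i) else 1)) :=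
    fun u => by
      rw [Finset.prod_mul_distrib, Finset.prod_mul_distrib]; simp
  simp_rw [h1]
  rw [sum_pi_prod (fun i a => p i a * ((if i = j then g a else 1) * (if i = k then h a else 1))),
    Finset.prod_eq_mul j k hjk]
  · simp [hjk, hjk.symm]
  · intro i _ hi
    simp [hi.1, hi.2, (hp i).2]
  · simp
  · simp

lemma sum_pi_marginal_pair {p : ι → α → ℝ} (hp : ∀ i, IsPMF (p i)) {j k : ι} (hjk : j ≠ k)
    (b : α → α → ℝ) :
    ∑ u : ι → α, (∏ i, p i (u i)) * b (u j) (u k) = ∑ t, p j t * ∑ t', p k t' * b t t' := by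
  classical
  have h1 : ∀ u : ι → α, (∏ i, p i (u i)) * b (u j) (u k)
      = ∑ t, (∏ i, p i (u i)) * ((if u j = t then 1 else 0) * b t (u k)) := fun u => by
    rw [← Finset.mul_sum]; simp
  simp_rw [h1]
  rw [Finset.sum_comm]
  refine Finset.sum_congr rfl fun t _ => ?_
  rw [sum_pi_marginal_mul hp hjk (fun a => if a = t then 1 else 0) (b t)]
  simp

lemma sum_pi_sq {n : ℕ} {p : α → ℝ} (hp : IsPMF p) (g : α → ℝ) (hg : ∑ a, p a * g a = 0) :
    ∑ u : Fin n → α, (∏ i, p (u i)) * (∑ i, g (u i)) ^ 2 = n * ∑ a, p a * g a ^ 2 := by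
  simp_rw [sq, Finset.sum_mul_sum, Finset.mul_sum]
  rw [Finset.sum_comm]
  have h1 : ∀ i : Fin n, ∑ u : Fin n → α, ∑ j, (∏ k, p (u k)) * (g (u i) * g (u j))
      = ∑ a, p a * (g a * g a) := fun i => by
    rw [Finset.sum_comm, Finset.sum_eq_single i]
    · exact sum_pi_marginal (p := fun _ => p) (fun _ => hp) i (fun a => g a * g a)
    · intro j _ hj
      rw [sum_pi_marginal_mul (p := fun _ => p) (fun _ => hp) hj.symm g g, hg, zero_mul]
    · simp
  simp [h1, Finset.mul_sum]

open Filter in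
lemma eventually_lower_tail_le {p : α → ℝ} (hp : IsPMF p) (f : α → ℝ) {c ε : ℝ}
    (hc : c < ∑ a, p a * f a) (hε : 0 < ε) :
    ∀ᶠ n : ℕ in atTop,
      ∑ u : Fin n → α, (∏ i, p (u i)) * ind (∑ i, f (u i) ≤ n * c) ≤ ε := by
  set μ := ∑ a, p a * f a with hμ
  set v := ∑ a, p a * (f a - μ) ^ 2 with hv
  have hδ : 0 < μ - c := sub_pos.2 hc
  have hg : ∑ a, p a * (f a - μ) = 0 := by
    simp_rw [mul_sub, Finset.sum_sub_distrib, ← Finset.sum_mul, hp.2]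
    rw [one_mul, ← hμ, sub_self]
  filter_upwards [eventually_ge_atTop (⌈v / ((μ - c) ^ 2 * ε)⌉₊ + 1)] with n hn
  have hn0 : (0 : ℝ) < n := by exact_mod_cast (show 0 < n by omega)
  have hnv : v / ((μ - c) ^ 2 * ε) ≤ n :=
    (Nat.le_ceil _).trans (by exact_mod_cast (show _ ≤ n by omega))
  have hpt : ∀ u : Fin n → α, (∏ i, p (u i)) * ind (∑ i, f (u i) ≤ n * c)
      ≤ (∏ i, p (u i)) * (∑ i, (f (u i) - μ)) ^ 2 * (1 / (n * (μ - c)) ^ 2) := fun u => by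
    rw [mul_assoc]
    refine mul_le_mul_of_nonneg_left (ind_le_of_imp (by positivity) fun h => ?_)
      (Finset.prod_nonneg fun i _ => hp.1 _)
    have h2 : n * (μ - c) ≤ -∑ i, (f (u i) - μ) := by
      simp only [Finset.sum_sub_distrib, Finset.sum_const, Finset.card_univ, Fintype.card_fin,
        nsmul_eq_mul]
      linarith
    rw [mul_one_div, one_le_div (by positivity), ← neg_sq (∑ i, (f (u i) - μ))]
    exact pow_le_pow_left₀ (by positivity) h2 2
  refine (Finset.sum_le_sum fun u _ => hpt u).trans ?_
  rw [← Finset.sum_mul, sum_pi_sq hp (fun a => f a - μ) hg, ← hv, mul_one_div,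
    div_le_iff₀ (by positivity)]
  rw [div_le_iff₀ (by positivity)] at hnv
  nlinarith

end ProductDistributions

section InformationDensity

variable {𝒳 𝒴 : Type} [Fintype 𝒳] [Fintype 𝒴]

/-- The threshold test `V^n(y|x) > e^{nα} Q^n(y)`, with `Q` the output distribution. -/
def InfoTest (P : 𝒳 → ℝ) (V : 𝒳 → 𝒴 → ℝ) (α : ℝ) {n : ℕ} (x : Fin n → 𝒳) (y : Fin n → 𝒴) : Prop :=
  Real.exp (n * α) * ∏ i, ∑ a, P a * V a (y i) < ∏ i, V (x i) (y i)

lemma sum_infoTest_le {P : 𝒳 → ℝ} (hP : IsPMF P) {V : 𝒳 → 𝒴 → ℝ} (hV : IsChannel V) (α : ℝ) {n : ℕ}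
    (y : Fin n → 𝒴) :
    ∑ x : Fin n → 𝒳, (∏ i, P (x i)) * ind (InfoTest P V α x y) ≤ Real.exp (-(n * α)) := by
  have hPn : ∀ x : Fin n → 𝒳, 0 ≤ ∏ i, P (x i) := fun x => Finset.prod_nonneg fun i _ => hP.1 _
  have hVn : ∀ x : Fin n → 𝒳, 0 ≤ ∏ i, V (x i) (y i) :=
    fun x => Finset.prod_nonneg fun i _ => (hV _).1 _
  have hQ : ∏ i, ∑ a, P a * V a (y i) = ∑ x : Fin n → 𝒳, (∏ i, P (x i)) * ∏ i, V (x i) (y i) := by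
    rw [← sum_pi_prod (fun i a => P a * V a (y i))]
    simp_rw [Finset.prod_mul_distrib]
  have hQ0 : 0 ≤ ∏ i, ∑ a, P a * V a (y i) := by
    rw [hQ]; exact Finset.sum_nonneg fun x _ => mul_nonneg (hPn x) (hVn x)
  rcases hQ0.eq_or_lt with h0 | hpos
  · refine le_trans (le_of_eq (Finset.sum_eq_zero fun x _ => ?_)) (Real.exp_pos _).le
    have h1 : (∏ i, P (x i)) * ∏ i, V (x i) (y i) = 0 := by
      rw [hQ, eq_comm, Finset.sum_eq_zero_iff_of_nonneg
        (fun x _ => mul_nonneg (hPn x) (hVn x))] at h0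
      exact h0 x (Finset.mem_univ x)
    rcases mul_eq_zero.1 h1 with h | h
    · rw [h, zero_mul]
    · rw [ind_of_not, mul_zero]
      rw [InfoTest, h, ← h0]
      simp
  · rw [Real.exp_neg, ← one_div, le_div_iff₀ (Real.exp_pos _)]
    refine le_of_mul_le_mul_right ?_ hpos
    rw [mul_assoc, Finset.sum_mul, one_mul]
    nth_rewrite 2 [hQ]
    refine Finset.sum_le_sum fun x _ => ?_
    rw [mul_assoc]
    refine mul_le_mul_of_nonneg_left ?_ (hPn x)
    by_cases h : InfoTest P V α x y
    · rw [ind_of h, one_mul]; exact h.le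
    · rw [ind_of_not h, zero_mul]; exact hVn x

open Filter in
lemma eventually_not_infoTest_le {P : 𝒳 → ℝ} (hP : IsPMF P) {V : 𝒳 → 𝒴 → ℝ} (hV : IsChannel V)
    {α ε : ℝ} (hα : α < mutualInfo P V) (hε : 0 < ε) :
    ∀ᶠ n : ℕ in atTop, ∑ x : Fin n → 𝒳, (∏ i, P (x i)) *
      ∑ y : Fin n → 𝒴, ind (¬ InfoTest P V α x y) * ∏ i, V (x i) (y i) ≤ ε := by
  have hJ : IsPMF (fun q : 𝒳 × 𝒴 => P q.1 * V q.1 q.2) := by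
    refine ⟨fun q => mul_nonneg (hP.1 _) ((hV _).1 _), ?_⟩
    rw [Fintype.sum_prod_type]
    simp_rw [← Finset.mul_sum, (hV _).2, mul_one, hP.2]
  have hmean : α < ∑ q : 𝒳 × 𝒴, P q.1 * V q.1 q.2 *
      Real.log (V q.1 q.2 / ∑ a, P a * V a q.2) := by
    rw [Fintype.sum_prod_type]; exact hα
  filter_upwards [eventually_lower_tail_le hJ
    (fun q => Real.log (V q.1 q.2 / ∑ a, P a * V a q.2)) hmean hε] with n hn
  refine le_trans ?_ hn
  rw [← (Equiv.arrowProdEquivProdArrow (Fin n) (fun _ => 𝒳) (fun _ => 𝒴)).symm.sum_comp,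
    Fintype.sum_prod_type]
  refine Finset.sum_le_sum fun x _ => ?_
  rw [Finset.mul_sum]
  refine Finset.sum_le_sum fun y _ => ?_
  simp only [Equiv.arrowProdEquivProdArrow, Equiv.coe_fn_symm_mk, Finset.prod_mul_distrib]
  by_cases hz : (∏ i, P (x i)) * ∏ i, V (x i) (y i) = 0
  · rw [hz, zero_mul, mul_left_comm, hz, mul_zero]
  have hP' : ∀ i, 0 < P (x i) := fun i =>
    (hP.1 _).lt_of_ne' (Finset.prod_ne_zero_iff.1 (left_ne_zero_of_mul hz) i (Finset.mem_univ i))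
  have hV' : ∀ i, 0 < V (x i) (y i) := fun i => ((hV _).1 _).lt_of_ne'
    (Finset.prod_ne_zero_iff.1 (right_ne_zero_of_mul hz) i (Finset.mem_univ i))
  have hQ' : ∀ i, 0 < ∑ a, P a * V a (y i) := fun i =>
    (mul_pos (hP' i) (hV' i)).trans_le <|
      Finset.single_le_sum (f := fun a => P a * V a (y i))
        (fun a _ => mul_nonneg (hP.1 _) ((hV _).1 _)) (Finset.mem_univ (x i))
  rw [mul_left_comm, mul_comm (ind _)]
  refine mul_le_mul_of_nonneg_left (ind_mono fun h => ?_)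
    (mul_nonneg (Finset.prod_nonneg fun i _ => (hP' i).le)
      (Finset.prod_nonneg fun i _ => (hV' i).le))
  rw [InfoTest, not_lt] at h
  rw [← Real.log_prod (fun i _ => (div_pos (hV' i) (hQ' i)).ne'), Finset.prod_div_distrib,
    Real.log_le_iff_le_exp (div_pos (Finset.prod_pos fun i _ => hV' i)
      (Finset.prod_pos fun i _ => hQ' i)),
    div_le_iff₀ (Finset.prod_pos fun i _ => hQ' i)]
  exact h

end InformationDensity

section RandomCoding

lemma IsPMF.exists_le {T : Type} [Fintype T] {p : T → ℝ} (hp : IsPMF p) {F : T → ℝ} {c : ℝ}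
    (h : ∑ t, p t * F t ≤ c) : ∃ t, F t ≤ c := by
  by_contra! hF
  obtain ⟨t, ht⟩ : ∃ t, 0 < p t := by
    by_contra! h0
    have := Finset.sum_nonpos fun t (_ : t ∈ Finset.univ) => h0 t
    rw [hp.2] at this
    linarith
  have : ∑ t, p t * c < ∑ t, p t * F t :=
    Finset.sum_lt_sum (fun t _ => mul_le_mul_of_nonneg_left (hF t).le (hp.1 t))
      ⟨t, Finset.mem_univ t, mul_lt_mul_of_pos_left (hF t) ht⟩
  rw [← Finset.sum_mul, hp.2, one_mul] at this
  linarith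

lemma exists_embedding_le {M : ℕ} {e : Fin (2 * M) → ℝ} (he : ∀ i, 0 ≤ e i) {ε : ℝ} (hε : 0 ≤ ε)
    (h : ∑ i, e i ≤ M * ε) : ∃ φ : Fin M ↪ Fin (2 * M), ∀ i, e (φ i) ≤ ε := by
  classical
  set G := Finset.univ.filter fun i => e i ≤ ε with hG
  set H := Finset.univ.filter fun i => ¬ e i ≤ ε with hH
  have hcard : G.card + H.card = 2 * M := by
    rw [hG, hH, Finset.card_filter_add_card_filter_not]; simp
  have hH' : H.card ≤ M := by
    by_contra! hlt
    have hne : H.Nonempty := Finset.card_pos.1 (by omega)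
    have h1 : ∑ _i ∈ H, ε < ∑ i ∈ H, e i :=
      Finset.sum_lt_sum_of_nonempty hne fun i hi => not_le.1 (Finset.mem_filter.1 hi).2
    have h2 : ∑ i ∈ H, e i ≤ ∑ i, e i :=
      Finset.sum_le_univ_sum_of_nonneg he
    rw [Finset.sum_const, nsmul_eq_mul] at h1
    have h3 : (M : ℝ) * ε ≤ H.card * ε :=
      mul_le_mul_of_nonneg_right (by exact_mod_cast hlt.le) hε
    linarith
  obtain ⟨φ⟩ : Nonempty (Fin M ↪ G) := by
    apply Function.Embedding.nonempty_of_card_le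
    simp only [Fintype.card_fin, Fintype.card_coe]
    omega
  exact ⟨φ.trans (Function.Embedding.subtype _), fun i => (Finset.mem_filter.1 (φ i).2).2⟩

/-- Decoding to a message passing a test `C`, when there is one. -/
lemma exists_test_decoder {T O : Type} {K : ℕ} (hK : 0 < K) (C : T → O → Prop) (τ : Fin K → T) :
    ∃ h : O → Fin K, ∀ i o,
      ind (h o ≠ i) ≤ ind (¬ C (τ i) o) + ∑ j ∈ Finset.univ.erase i, ind (C (τ j) o) := by
  classical
  refine ⟨fun o => if H : ∃ j, C (τ j) o then H.choose else ⟨0, hK⟩, fun i o => ?_⟩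
  have hs : 0 ≤ ∑ j ∈ Finset.univ.erase i, ind (C (τ j) o) :=
    Finset.sum_nonneg fun j _ => ind_nonneg _
  by_cases hC : C (τ i) o
  · have H : ∃ j, C (τ j) o := ⟨i, hC⟩
    rw [ind_of_not (not_not.2 hC), zero_add]
    refine ind_le_of_imp hs fun hne => ?_
    simp only [dif_pos H] at hne
    rw [← ind_of H.choose_spec]
    exact Finset.single_le_sum (f := fun j => ind (C (τ j) o)) (fun j _ => ind_nonneg _)
      (Finset.mem_erase.2 ⟨hne, Finset.mem_univ _⟩)
  · rw [ind_of hC]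
    linarith [ind_le_one ((if H : ∃ j, C (τ j) o then H.choose else ⟨0, hK⟩) ≠ i)]

variable {T O S : Type} [Fintype T] [Fintype O] [Fintype S]

/-- Random coding with expurgation, over a family of channels `K s` and a universal test `C`. -/
lemma exists_random_code {p : T → ℝ} (hp : IsPMF p) {K : S → T → O → ℝ}
    (hK : ∀ s t, IsPMF (K s t)) (C : T → O → Prop) (Bad : T → Prop) {η β ε : ℝ} {M : ℕ}
    (hM : 0 < M)
    (h1 : ∑ t, p t * (ind (Bad t) + ∑ s, ∑ o, ind (¬ C t o) * K s t o) ≤ η)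
    (h2 : ∀ o, ∑ t, p t * ind (C t o) ≤ β) (hε0 : 0 ≤ ε) (hε1 : ε < 1)
    (hb : 2 * η + 4 * M * (Fintype.card S * β) ≤ ε) :
    ∃ (t : Fin M → T) (h : O → Fin M), ∀ w, ¬ Bad (t w) ∧
      ∀ s, ∑ o, ind (h o ≠ w) * K s (t w) o ≤ ε := by
  classical
  set a : T → ℝ := fun t => ind (Bad t) + ∑ s, ∑ o, ind (¬ C t o) * K s t o with ha
  set b : T → T → ℝ := fun t t' => ∑ s, ∑ o, K s t o * ind (C t' o) with hbdef
  have hK0 : ∀ s t o, 0 ≤ K s t o := fun s t => (hK s t).1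
  have ha0 : ∀ t, 0 ≤ ∑ s, ∑ o, ind (¬ C t o) * K s t o := fun t =>
    Finset.sum_nonneg fun s _ => Finset.sum_nonneg fun o _ => mul_nonneg (ind_nonneg _) (hK0 _ _ _)
  have hb0 : ∀ t t', 0 ≤ b t t' := fun t t' =>
    Finset.sum_nonneg fun s _ => Finset.sum_nonneg fun o _ => mul_nonneg (hK0 _ _ _) (ind_nonneg _)
  have hβ0 : 0 ≤ Fintype.card S * β := by
    obtain ⟨t, -⟩ := hp.exists_le (F := fun _ => 0) (c := 0) (by simp)
    rcases isEmpty_or_nonempty S with hS | ⟨⟨s⟩⟩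
    · simp
    · obtain ⟨o, -⟩ := (hK s t).exists_le (F := fun _ => 0) (c := 0) (by simp)
      exact mul_nonneg (Nat.cast_nonneg _) <|
        (Finset.sum_nonneg fun t _ => mul_nonneg (hp.1 t) (ind_nonneg _)).trans (h2 o)
  have hbmean : ∀ t, ∑ t', p t' * b t t' ≤ Fintype.card S * β := fun t => by
    simp only [hbdef, Finset.mul_sum]
    rw [Finset.sum_comm, ← nsmul_eq_mul, ← Finset.card_univ]
    refine Finset.sum_le_card_nsmul _ _ _ fun s _ => ?_
    rw [Finset.sum_comm]
    calc ∑ o, ∑ t', p t' * (K s t o * ind (C t' o))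
        = ∑ o, K s t o * ∑ t', p t' * ind (C t' o) := by
          simp_rw [Finset.mul_sum]
          exact Finset.sum_congr rfl fun o _ => Finset.sum_congr rfl fun t' _ => by ring
      _ ≤ ∑ o, K s t o * β :=
          Finset.sum_le_sum fun o _ => mul_le_mul_of_nonneg_left (h2 o) (hK0 _ _ _)
      _ = β := by rw [← Finset.sum_mul, (hK s t).2, one_mul]
  set e : (Fin (2 * M) → T) → Fin (2 * M) → ℝ := fun τ i =>
    a (τ i) + ∑ j ∈ Finset.univ.erase i, b (τ i) (τ j) with he
  have hmean : ∑ τ : Fin (2 * M) → T, (∏ i, p (τ i)) * ∑ i, e τ i ≤ M * ε := by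
    simp_rw [Finset.mul_sum]
    rw [Finset.sum_comm]
    have hi : ∀ i, ∑ τ : Fin (2 * M) → T, (∏ k, p (τ k)) * e τ i
        ≤ η + 2 * M * (Fintype.card S * β) := fun i => by
      simp only [he, mul_add, Finset.mul_sum, Finset.sum_add_distrib]
      refine add_le_add ?_ ?_
      · rw [sum_pi_marginal (p := fun _ => p) (fun _ => hp) i a]; exact h1
      · rw [Finset.sum_comm]
        calc ∑ j ∈ Finset.univ.erase i, ∑ τ : Fin (2 * M) → T, (∏ k, p (τ k)) * b (τ i) (τ j)
            ≤ ∑ j ∈ Finset.univ.erase i, (Fintype.card S * β) := by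
              refine Finset.sum_le_sum fun j hj => ?_
              rw [sum_pi_marginal_pair (p := fun _ => p) (fun _ => hp)
                (Finset.mem_erase.1 hj).1.symm b]
              calc _ ≤ ∑ t, p t * (Fintype.card S * β) :=
                    Finset.sum_le_sum fun t _ => mul_le_mul_of_nonneg_left (hbmean t) (hp.1 t)
                _ = _ := by rw [← Finset.sum_mul, hp.2, one_mul]
          _ ≤ ∑ j : Fin (2 * M), (Fintype.card S * β) :=
              Finset.sum_le_sum_of_subset_of_nonneg (Finset.erase_subset _ _) fun _ _ _ => hβ0
          _ = 2 * M * (Fintype.card S * β) := by simp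
    refine (Finset.sum_le_sum fun i _ => hi i).trans ?_
    simp only [Finset.sum_const, Finset.card_univ, Fintype.card_fin, nsmul_eq_mul]
    push_cast
    nlinarith [mul_le_mul_of_nonneg_left hb (Nat.cast_nonneg (α := ℝ) M)]
  obtain ⟨τ, hτ⟩ := (IsPMF.pi (p := fun (_ : Fin (2 * M)) => p) fun _ => hp).exists_le hmean
  have he0 : ∀ i, 0 ≤ e τ i := fun i =>
    add_nonneg (add_nonneg (ind_nonneg _) (ha0 _)) (Finset.sum_nonneg fun j _ => hb0 _ _)
  obtain ⟨φ, hφ⟩ := exists_embedding_le he0 hε0 hτ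
  obtain ⟨h, hh⟩ := exists_test_decoder (by omega : 0 < 2 * M) C τ
  have : Nonempty (Fin M) := ⟨⟨0, hM⟩⟩
  refine ⟨fun w => τ (φ w), fun o => Function.invFun φ (h o), fun w => ⟨fun hbad => ?_, fun s => ?_⟩⟩
  · have := hφ w
    simp only [he, ha, ind_of hbad] at this
    linarith [ha0 (τ (φ w)),
      Finset.sum_nonneg fun j (_ : j ∈ Finset.univ.erase (φ w)) => hb0 (τ (φ w)) (τ j)]
  · refine le_trans ?_ (hφ w)
    have hsplit : ∀ o, ind (Function.invFun φ (h o) ≠ w) * K s (τ (φ w)) o ≤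
        ind (¬ C (τ (φ w)) o) * K s (τ (φ w)) o +
          ∑ j ∈ Finset.univ.erase (φ w), K s (τ (φ w)) o * ind (C (τ j) o) := fun o => by
      rw [← Finset.mul_sum, mul_comm (K s _ o), ← add_mul]
      refine mul_le_mul_of_nonneg_right (le_trans (ind_mono fun hne heq => hne ?_) (hh (φ w) o))
        (hK0 _ _ _)
      rw [heq, Function.leftInverse_invFun φ.injective]
    refine (Finset.sum_le_sum fun o _ => hsplit o).trans ?_
    rw [Finset.sum_add_distrib, Finset.sum_comm]
    refine add_le_add ?_ (Finset.sum_le_sum fun j _ => ?_)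
    · refine le_trans ?_ (le_add_of_nonneg_left (ind_nonneg _))
      exact Finset.single_le_sum (f := fun s => ∑ o, ind (¬ C (τ (φ w)) o) * K s (τ (φ w)) o)
        (fun s _ => Finset.sum_nonneg fun o _ => mul_nonneg (ind_nonneg _) (hK0 _ _ _))
        (Finset.mem_univ s)
    · exact Finset.single_le_sum (f := fun s => ∑ o, K s (τ (φ w)) o * ind (C (τ j) o))
        (fun s _ => Finset.sum_nonneg fun o _ => mul_nonneg (hK0 _ _ _) (ind_nonneg _))
        (Finset.mem_univ s)

end RandomCoding

section MaximumLikelihood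

variable {𝒳 𝒵 𝒮 : Type} [Fintype 𝒵]

lemma pow0_nonneg {a : ℝ} (ha : 0 ≤ a) (ℓ : ℝ) : 0 ≤ pow0 a ℓ := by
  unfold pow0; split_ifs
  · exact le_rfl
  · exact Real.rpow_nonneg ha ℓ

lemma chernoffSum_nonneg {w w' : 𝒵 → ℝ} (hw : IsPMF w) (hw' : IsPMF w') (ℓ : ℝ) :
    0 ≤ chernoffSum w w' ℓ :=
  Finset.sum_nonneg fun z _ => mul_nonneg (pow0_nonneg (hw.1 z) _) (pow0_nonneg (hw'.1 z) _)

lemma chernoffSum_le_one {w w' : 𝒵 → ℝ} (hw : IsPMF w) (hw' : IsPMF w') {ℓ : ℝ}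
    (hℓ : ℓ ∈ Set.Icc (0 : ℝ) 1) : chernoffSum w w' ℓ ≤ 1 := by
  have h1 : ∀ z, pow0 (w z) ℓ * pow0 (w' z) (1 - ℓ) ≤ ℓ * w z + (1 - ℓ) * w' z := fun z => by
    have h0 : 0 ≤ ℓ * w z + (1 - ℓ) * w' z :=
      add_nonneg (mul_nonneg hℓ.1 (hw.1 z)) (mul_nonneg (sub_nonneg.2 hℓ.2) (hw'.1 z))
    unfold pow0
    split_ifs
    · simpa using h0
    · simpa using h0
    · simpa using h0
    · exact Real.geom_mean_le_arith_mean2_weighted hℓ.1 (sub_nonneg.2 hℓ.2) (hw.1 z) (hw'.1 z)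
        (by ring)
  refine (Finset.sum_le_sum fun z _ => h1 z).trans (le_of_eq ?_)
  rw [Finset.sum_add_distrib, ← Finset.mul_sum, ← Finset.mul_sum, hw.2, hw'.2]
  ring

lemma prod_chernoffSum_le {V V' : 𝒳 → 𝒵 → ℝ} (hV : ∀ x, IsPMF (V x)) (hV' : ∀ x, IsPMF (V' x))
    {n : ℕ} (x : Fin n → 𝒳) (ℓ : ℝ) :
    ∏ i, chernoffSum (V (x i)) (V' (x i)) ℓ
      ≤ Real.exp (-∑ i, -Real.log (chernoffSum (V (x i)) (V' (x i)) ℓ)) := by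
  rw [Finset.sum_neg_distrib, neg_neg, Real.exp_sum]
  refine Finset.prod_le_prod (fun i _ => chernoffSum_nonneg (hV _) (hV' _) _) fun i _ => ?_
  rcases (chernoffSum_nonneg (hV (x i)) (hV' (x i)) ℓ).eq_or_lt with h0 | hpos
  · rw [← h0]; simp
  · rw [Real.exp_log hpos]

lemma sum_ind_le_mul_prod_le {n : ℕ} {V V' : 𝒳 → 𝒵 → ℝ} (hV : ∀ x, IsPMF (V x))
    (hV' : ∀ x, IsPMF (V' x)) (x : Fin n → 𝒳) {ℓ : ℝ} (hℓ : ℓ ∈ Set.Icc (0 : ℝ) 1) :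
    ∑ z : Fin n → 𝒵, ind (∏ i, V (x i) (z i) ≤ ∏ i, V' (x i) (z i)) * ∏ i, V (x i) (z i)
      ≤ ∏ i, chernoffSum (V (x i)) (V' (x i)) ℓ := by
  unfold chernoffSum
  rw [← sum_pi_prod (fun i z => pow0 (V (x i) z) ℓ * pow0 (V' (x i) z) (1 - ℓ))]
  refine Finset.sum_le_sum fun z _ => ?_
  have hr : 0 ≤ ∏ i, pow0 (V (x i) (z i)) ℓ * pow0 (V' (x i) (z i)) (1 - ℓ) :=
    Finset.prod_nonneg fun i _ =>
      mul_nonneg (pow0_nonneg ((hV _).1 _) _) (pow0_nonneg ((hV' _).1 _) _)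
  by_cases hle : ∏ i, V (x i) (z i) ≤ ∏ i, V' (x i) (z i)
  · rw [ind_of hle, one_mul]
    rcases (Finset.prod_nonneg fun i (_ : i ∈ Finset.univ) => (hV (x i)).1 (z i)).eq_or_lt
      with h0 | hpos
    · rw [← h0]; exact hr
    have hne : ∀ i, V (x i) (z i) ≠ 0 := fun i =>
      Finset.prod_ne_zero_iff.1 hpos.ne' i (Finset.mem_univ i)
    have hne' : ∀ i, V' (x i) (z i) ≠ 0 := fun i =>
      Finset.prod_ne_zero_iff.1 (hpos.trans_le hle).ne' i (Finset.mem_univ i)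
    simp only [pow0, hne, hne', if_false]
    rw [Finset.prod_mul_distrib, Real.finsetProd_rpow _ _ fun i _ => (hV _).1 _,
      Real.finsetProd_rpow _ _ fun i _ => (hV' _).1 _]
    calc ∏ i, V (x i) (z i)
        = (∏ i, V (x i) (z i)) ^ ℓ * (∏ i, V (x i) (z i)) ^ (1 - ℓ) := by
          rw [← Real.rpow_add hpos]; simp
      _ ≤ _ := mul_le_mul_of_nonneg_left
          (Real.rpow_le_rpow hpos.le hle (sub_nonneg.2 hℓ.2)) (Real.rpow_nonneg hpos.le _)
  · rw [ind_of_not hle, zero_mul]; exact hr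

/-- Maximum-likelihood state estimation, with the Chernoff bound on its error probability. -/
lemma exists_ml_estimator [Fintype 𝒮] [DecidableEq 𝒮] [Nonempty 𝒮] {V : 𝒮 → 𝒳 → 𝒵 → ℝ}
    (hV : ∀ s x, IsPMF (V s x)) (n : ℕ) :
    ∃ g : (Fin n → 𝒳) → (Fin n → 𝒵) → 𝒮, ∀ x s (ℓ : 𝒮 → ℝ), (∀ s', ℓ s' ∈ Set.Icc (0 : ℝ) 1) →
      ∑ z, ind (g x z ≠ s) * ∏ i, V s (x i) (z i) ≤
        ∑ s' ∈ Finset.univ.erase s, ∏ i, chernoffSum (V s (x i)) (V s' (x i)) (ℓ s') := by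
  have hmax : ∀ (x : Fin n → 𝒳) (z : Fin n → 𝒵),
      ∃ s₀, ∀ s, ∏ i, V s (x i) (z i) ≤ ∏ i, V s₀ (x i) (z i) :=
    fun x z => Finite.exists_max fun s => ∏ i, V s (x i) (z i)
  choose g hg using hmax
  refine ⟨g, fun x s ℓ hℓ => ?_⟩
  refine le_trans ?_ (Finset.sum_le_sum fun s' _ =>
    sum_ind_le_mul_prod_le (hV s) (hV s') x (hℓ s'))
  rw [Finset.sum_comm]
  refine Finset.sum_le_sum fun z _ => ?_
  rw [← Finset.sum_mul]
  refine mul_le_mul_of_nonneg_right (ind_le_of_imp (Finset.sum_nonneg fun _ _ => ind_nonneg _)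
    fun hne => ?_) (Finset.prod_nonneg fun i _ => (hV _ _).1 _)
  rw [← ind_of (hg x z s)]
  exact Finset.single_le_sum
    (f := fun s' => ind (∏ i, V s (x i) (z i) ≤ ∏ i, V s' (x i) (z i)))
    (fun _ _ => ind_nonneg _) (Finset.mem_erase.2 ⟨hne, Finset.mem_univ _⟩)

/-- Each pair of states distinguishable by some input can be told apart from a long enough
fixed training sequence. -/
lemma exists_training [Fintype 𝒳] [Fintype 𝒮] [DecidableEq 𝒮] [Nonempty 𝒮] {V : 𝒮 → 𝒳 → 𝒵 → ℝ}
    (hV : ∀ s x, IsPMF (V s x))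
    (hd : ∀ s s', s ≠ s' → ∃ ℓ ∈ Set.Icc (0 : ℝ) 1, ∃ x, chernoffSum (V s x) (V s' x) ℓ < 1)
    {ε : ℝ} (hε : 0 < ε) :
    ∃ (m : ℕ) (x : Fin m → 𝒳) (est : (Fin m → 𝒵) → 𝒮),
      ∀ s, ∑ z, ind (est z ≠ s) * ∏ i, V s (x i) (z i) ≤ ε := by
  have hd' : ∀ s s', ∃ ℓ ∈ Set.Icc (0 : ℝ) 1,
      s ≠ s' → ∏ x, chernoffSum (V s x) (V s' x) ℓ < 1 := fun s s' => by
    by_cases hs : s = s'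
    · exact ⟨0, by simp, fun h => absurd hs h⟩
    obtain ⟨ℓ, hℓ, x, hx⟩ := hd s s' hs
    refine ⟨ℓ, hℓ, fun _ => ?_⟩
    classical
    rw [← Finset.mul_prod_erase _ _ (Finset.mem_univ x)]
    refine lt_of_le_of_lt ?_ hx
    exact mul_le_of_le_one_right (chernoffSum_nonneg (hV _ _) (hV _ _) _)
      (Finset.prod_le_one (fun y _ => chernoffSum_nonneg (hV _ _) (hV _ _) _)
        fun y _ => chernoffSum_le_one (hV _ _) (hV _ _) hℓ)
  choose ℓ hℓ hlt using hd'
  have hlim : ∀ s, Filter.Tendsto (fun k : ℕ => ∑ s' ∈ Finset.univ.erase s,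
      (∏ x, chernoffSum (V s x) (V s' x) (ℓ s s')) ^ k) Filter.atTop (nhds 0) := fun s => by
    rw [← Finset.sum_const_zero (s := Finset.univ.erase s)]
    exact tendsto_finsetSum _ fun s' hs' => tendsto_pow_atTop_nhds_zero_of_lt_one
      (Finset.prod_nonneg fun x _ => chernoffSum_nonneg (hV _ _) (hV _ _) _)
      (hlt s s' (Finset.mem_erase.1 hs').1.symm)
  obtain ⟨k, hk⟩ := (Filter.eventually_all.2 fun s => (hlim s).eventually_le_const hε).exists
  let q := Fintype.equivFin (Fin k × 𝒳)
  obtain ⟨g, hg⟩ := exists_ml_estimator hV (Fintype.card (Fin k × 𝒳))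
  refine ⟨_, fun i => (q.symm i).2, g fun i => (q.symm i).2, fun s => ?_⟩
  refine (hg _ s (ℓ s) (hℓ s)).trans ((Finset.sum_le_sum fun s' _ => le_of_eq ?_).trans (hk s))
  rw [q.symm.prod_comp fun r => chernoffSum (V s r.2) (V s' r.2) (ℓ s s'), Fintype.prod_prod_type]
  simp

end MaximumLikelihood

section Codebook

variable {𝒳 𝒴 𝒮 κ : Type} [Fintype 𝒳] [Fintype 𝒴] [Fintype 𝒮] [DecidableEq 𝒮]

lemma sum_tuple_marginal {P : 𝒮 → 𝒳 → ℝ} (hP : ∀ s, IsPMF (P s)) {n : ℕ} (s : 𝒮)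
    (g : (Fin n → 𝒳) → ℝ) :
    ∑ t : 𝒮 → Fin n → 𝒳, (∏ s', ∏ i, P s' (t s' i)) * g (t s) = ∑ x, (∏ i, P s (x i)) * g x :=
  sum_pi_marginal (p := fun s' (x : Fin n → 𝒳) => ∏ i, P s' (x i))
    (fun s' => IsPMF.pi fun _ => hP s') s g

open Filter

lemma eventually_atypical_le [Fintype κ] {P : 𝒮 → 𝒳 → ℝ} (hP : ∀ s, IsPMF (P s))
    {L : 𝒮 → κ → 𝒳 → ℝ} {c : ℝ} (hL : ∀ s k, c < ∑ x, P s x * L s k x) {η : ℝ} (hη : 0 < η) :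
    ∀ᶠ n : ℕ in atTop, ∑ t : 𝒮 → Fin n → 𝒳, (∏ s, ∏ i, P s (t s i)) *
      ind (∃ q : 𝒮 × κ, ∑ i, L q.1 q.2 (t q.1 i) ≤ n * c) ≤ η := by
  have hη' : 0 < η / (Fintype.card (𝒮 × κ) + 1) := by positivity
  filter_upwards [eventually_all.2 fun q : 𝒮 × κ =>
    eventually_lower_tail_le (hP q.1) (L q.1 q.2) (hL q.1 q.2) hη'] with n hn
  calc _ ≤ ∑ t : 𝒮 → Fin n → 𝒳, ∑ q : 𝒮 × κ, (∏ s, ∏ i, P s (t s i)) *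
        ind (∑ i, L q.1 q.2 (t q.1 i) ≤ n * c) := by
        refine Finset.sum_le_sum fun t _ => ?_
        rw [← Finset.mul_sum]
        exact mul_le_mul_of_nonneg_left (ind_exists_le _)
          (Finset.prod_nonneg fun s _ => Finset.prod_nonneg fun i _ => (hP s).1 _)
    _ ≤ ∑ _q : 𝒮 × κ, η / (Fintype.card (𝒮 × κ) + 1) := by
        rw [Finset.sum_comm]
        refine Finset.sum_le_sum fun q _ => ?_
        rw [sum_tuple_marginal hP q.1 fun x => ind (∑ i, L q.1 q.2 (x i) ≤ n * c)]
        exact hn q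
    _ ≤ η := by
        rw [Finset.sum_const, Finset.card_univ, nsmul_eq_mul, mul_div_assoc',
          div_le_iff₀ (by positivity)]
        nlinarith

/-- Codebooks with one codeword per message and state: each codeword is typical for its state, and
one decoder, ignorant of the state, has small error probability in every state. -/
lemma eventually_exists_codebook [Nonempty 𝒮] [Fintype κ] {P : 𝒮 → 𝒳 → ℝ} (hP : ∀ s, IsPMF (P s))
    {V : 𝒮 → 𝒳 → 𝒴 → ℝ} (hV : ∀ s, IsChannel (V s)) {R : ℝ}
    (hR : 0 < R → ∀ s, R < mutualInfo (P s) (V s))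
    {L : 𝒮 → κ → 𝒳 → ℝ} {c : ℝ} (hL : ∀ s k, c < ∑ x, P s x * L s k x) {ε : ℝ} (hε : 0 < ε) :
    ∀ᶠ n : ℕ in atTop, ∃ (M : ℕ) (x : Fin M → 𝒮 → Fin n → 𝒳) (h : (Fin n → 𝒴) → Fin M),
      0 < M ∧ n * R ≤ Real.log M ∧ ∀ w s, (∀ k, n * c < ∑ i, L s k (x w s i)) ∧
        ∑ y, ind (h y ≠ w) * ∏ i, V s (x w s i) (y i) ≤ ε := by
  have hpn : ∀ n, IsPMF (fun t : 𝒮 → Fin n → 𝒳 => ∏ s, ∏ i, P s (t s i)) := fun n =>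
    IsPMF.pi (p := fun s (x : Fin n → 𝒳) => ∏ i, P s (x i)) fun s => IsPMF.pi fun _ => hP s
  rcases le_or_gt R 0 with hR0 | hR0
  · filter_upwards [eventually_atypical_le hP hL (one_half_pos (α := ℝ))] with n hn
    obtain ⟨t, ht⟩ := (hpn n).exists_le hn
    have htyp : ¬ ∃ q : 𝒮 × κ, ∑ i, L q.1 q.2 (t q.1 i) ≤ n * c := fun hq => by
      rw [ind_of hq] at ht; norm_num at ht
    push Not at htyp
    refine ⟨1, fun _ => t, fun _ => 0, one_pos, ?_, fun w s => ⟨fun k => htyp (s, k), ?_⟩⟩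
    · simpa using mul_nonpos_of_nonneg_of_nonpos (Nat.cast_nonneg n) hR0
    · refine le_trans (le_of_eq (Finset.sum_eq_zero fun y _ => ?_)) hε.le
      rw [ind_of_not (not_not.2 (Subsingleton.elim _ _)), zero_mul]
  · obtain ⟨s₀, hs₀⟩ := Finite.exists_min fun s => mutualInfo (P s) (V s)
    obtain ⟨α, hRα, hα⟩ := exists_between (hR hR0 s₀)
    set ε' := min ε (1 / 2) with hε'
    have hε'0 : 0 < ε' := lt_min hε (by norm_num)
    have hcard : (0 : ℝ) < Fintype.card 𝒮 := by exact_mod_cast Fintype.card_pos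
    have hη : 0 < ε' / 8 := by positivity
    have hη' : 0 < ε' / 8 / Fintype.card 𝒮 := by positivity
    have hlim : Tendsto (fun n : ℕ => 8 * (Fintype.card 𝒮 : ℝ) ^ 2 * Real.exp (-(α - R)) ^ n)
        atTop (nhds 0) := by
      rw [← mul_zero (8 * (Fintype.card 𝒮 : ℝ) ^ 2)]
      exact (tendsto_pow_atTop_nhds_zero_of_lt_one (Real.exp_pos _).le
        (Real.exp_zero ▸ Real.exp_lt_exp.2 (by linarith))).const_mul _
    filter_upwards [eventually_atypical_le hP hL hη,
      eventually_all.2 fun s => eventually_not_infoTest_le (hP s) (hV s)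
        (hα.trans_le (hs₀ s)) hη', hlim.eventually_le_const (half_pos hε'0)] with n h1 h2 h3
    have hM : 0 < ⌈Real.exp (n * R)⌉₊ := Nat.ceil_pos.2 (Real.exp_pos _)
    have hM2 : (⌈Real.exp (n * R)⌉₊ : ℝ) ≤ 2 * Real.exp (n * R) := by
      have := (Nat.ceil_lt_add_one (Real.exp_pos (n * R)).le).le
      have := Real.one_le_exp (x := n * R) (by positivity)
      linarith
    have hp0 : ∀ t : 𝒮 → Fin n → 𝒳, 0 ≤ ∏ s, ∏ i, P s (t s i) := (hpn n).1
    obtain ⟨t, h, ht⟩ := exists_random_code (hpn n)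
      (K := fun s (t : 𝒮 → Fin n → 𝒳) (y : Fin n → 𝒴) => ∏ i, V s (t s i) (y i))
      (fun s t => IsPMF.pi fun i => hV s (t s i))
      (fun t y => ∃ s, InfoTest (P s) (V s) α (t s) y)
      (fun t => ∃ q : 𝒮 × κ, ∑ i, L q.1 q.2 (t q.1 i) ≤ n * c)
      (η := ε' / 4) (β := Fintype.card 𝒮 * Real.exp (-(n * α))) hM
      (by
        simp_rw [mul_add, Finset.sum_add_distrib]
        have : ∑ t : 𝒮 → Fin n → 𝒳, (∏ s, ∏ i, P s (t s i)) * ∑ s, ∑ y : Fin n → 𝒴,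
            ind (¬ ∃ s, InfoTest (P s) (V s) α (t s) y) * ∏ i, V s (t s i) (y i) ≤ ε' / 8 := by
          calc _ ≤ ∑ t : 𝒮 → Fin n → 𝒳, ∑ s, (∏ s, ∏ i, P s (t s i)) * ∑ y : Fin n → 𝒴,
                ind (¬ InfoTest (P s) (V s) α (t s) y) * ∏ i, V s (t s i) (y i) := by
                refine Finset.sum_le_sum fun t _ => ?_
                rw [← Finset.mul_sum]
                refine mul_le_mul_of_nonneg_left (Finset.sum_le_sum fun s _ =>
                  Finset.sum_le_sum fun y _ => ?_) (hp0 t)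
                exact mul_le_mul_of_nonneg_right (ind_mono fun hn hs => hn ⟨s, hs⟩)
                  (Finset.prod_nonneg fun i _ => (hV s _).1 _)
            _ ≤ ∑ _s : 𝒮, ε' / 8 / Fintype.card 𝒮 := by
                rw [Finset.sum_comm]
                refine Finset.sum_le_sum fun s _ => ?_
                rw [sum_tuple_marginal hP s fun x => ∑ y : Fin n → 𝒴,
                  ind (¬ InfoTest (P s) (V s) α x y) * ∏ i, V s (x i) (y i)]
                exact h2 s
            _ = ε' / 8 := by
                rw [Finset.sum_const, Finset.card_univ, nsmul_eq_mul]
                field_simp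
        linarith)
      (fun y => by
        calc _ ≤ ∑ t : 𝒮 → Fin n → 𝒳, ∑ s, (∏ s, ∏ i, P s (t s i)) *
              ind (InfoTest (P s) (V s) α (t s) y) := by
              refine Finset.sum_le_sum fun t _ => ?_
              rw [← Finset.mul_sum]
              exact mul_le_mul_of_nonneg_left (ind_exists_le _) (hp0 t)
          _ ≤ ∑ _s : 𝒮, Real.exp (-(n * α)) := by
              rw [Finset.sum_comm]
              refine Finset.sum_le_sum fun s _ => ?_
              rw [sum_tuple_marginal hP s fun x => ind (InfoTest (P s) (V s) α x y)]
              exact sum_infoTest_le (hP s) (hV s) α y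
          _ = _ := by rw [Finset.sum_const, Finset.card_univ, nsmul_eq_mul])
      hε'0.le ((min_le_right _ _).trans_lt (by norm_num))
      (by
        have hexp : Real.exp (n * R) * Real.exp (-(n * α)) = Real.exp (-(α - R)) ^ n := by
          rw [← Real.exp_add, ← Real.exp_nat_mul]; ring_nf
        have h4 : 4 * (⌈Real.exp (n * R)⌉₊ : ℝ) *
            (Fintype.card 𝒮 * (Fintype.card 𝒮 * Real.exp (-(n * α)))) ≤
            8 * (Fintype.card 𝒮 : ℝ) ^ 2 * Real.exp (-(α - R)) ^ n := by
          rw [← hexp]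
          have := mul_le_mul_of_nonneg_right hM2
            (show 0 ≤ 4 * (Fintype.card 𝒮 : ℝ) ^ 2 * Real.exp (-(n * α)) by positivity)
          linarith
        linarith)
    refine ⟨_, t, h, hM, ?_, fun w s => ⟨fun k => ?_, ((ht w).2 s).trans (min_le_left _ _)⟩⟩
    · rw [Real.le_log_iff_exp_le (by exact_mod_cast hM)]
      exact Nat.le_ceil _
    · have := (ht w).1
      push Not at this
      exact this (s, k)

end Codebook

section TwoPhase

variable {𝒳 𝒴 𝒵 𝒮 : Type}

/-- The closed-loop encoder that sends the training sequence `tr` and then the block `c z`,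
chosen from the feedback `z` on the training sequence. -/
def twoPhase {m n : ℕ} (tr : Fin m → 𝒳) (c : (Fin m → 𝒵) → Fin n → 𝒳) (i : Fin (m + n))
    (z : Fin i.val → 𝒵) : 𝒳 :=
  if h : i.val < m then tr ⟨i.val, h⟩
  else c (fun j => z ⟨j.val, j.2.trans_le (not_lt.1 h)⟩)
    ⟨i.val - m, Nat.sub_lt_left_of_lt_add (not_lt.1 h) i.2⟩

lemma xReal_twoPhase_castAdd {m n : ℕ} (tr : Fin m → 𝒳) (c : (Fin m → 𝒵) → Fin n → 𝒳)
    (yz : Fin (m + n) → 𝒴 × 𝒵) (i : Fin m) :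
    xReal (twoPhase tr c) yz (Fin.castAdd n i) = tr i := by
  simp [xReal, twoPhase]

lemma xReal_twoPhase_natAdd {m n : ℕ} (tr : Fin m → 𝒳) (c : (Fin m → 𝒵) → Fin n → 𝒳)
    (u : Fin m → 𝒴 × 𝒵) (v : Fin n → 𝒴 × 𝒵) (i : Fin n) :
    xReal (twoPhase tr c) (Fin.append u v) (Fin.natAdd m i) = c (fun j => (u j).2) i := by
  have hu : ∀ j : Fin m, Fin.append u v ⟨j.val, j.2.trans_le (Nat.le_add_right m n)⟩ = u j :=
    fun j => Fin.append_left u v j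
  simp [xReal, twoPhase, hu]

variable [Fintype 𝒴] [Fintype 𝒵]

lemma isPMF_margY {W : 𝒳 → 𝒮 → 𝒴 × 𝒵 → ℝ} (hW : ∀ x s, IsPMF (W x s)) (s : 𝒮) (x : 𝒳) :
    IsPMF (margY W s x) :=
  ⟨fun _ => Finset.sum_nonneg fun _ _ => (hW x s).1 _, by
    rw [← (hW x s).2, Fintype.sum_prod_type]; rfl⟩

lemma isPMF_margZ {W : 𝒳 → 𝒮 → 𝒴 × 𝒵 → ℝ} (hW : ∀ x s, IsPMF (W x s)) (s : 𝒮) (x : 𝒳) :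
    IsPMF (margZ W s x) :=
  ⟨fun _ => Finset.sum_nonneg fun _ _ => (hW x s).1 _, by
    rw [← (hW x s).2, Fintype.sum_prod_type_right]; rfl⟩

lemma sum_prod_eq_margY (W : 𝒳 → 𝒮 → 𝒴 × 𝒵 → ℝ) {n : ℕ} (x : Fin n → 𝒳) (s : 𝒮)
    (g : (Fin n → 𝒴) → ℝ) :
    ∑ v : Fin n → 𝒴 × 𝒵, g (fun i => (v i).1) * ∏ i, W (x i) s (v i)
      = ∑ y, g y * ∏ i, margY W s (x i) (y i) := by
  rw [← (Equiv.arrowProdEquivProdArrow (Fin n) (fun _ => 𝒴) (fun _ => 𝒵)).symm.sum_comp,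
    Fintype.sum_prod_type]
  refine Finset.sum_congr rfl fun y _ => ?_
  simp only [Equiv.arrowProdEquivProdArrow, Equiv.coe_fn_symm_mk, margY]
  rw [← Finset.mul_sum, ← sum_pi_prod fun i z => W (x i) s (y i, z)]

lemma sum_prod_eq_margZ (W : 𝒳 → 𝒮 → 𝒴 × 𝒵 → ℝ) {n : ℕ} (x : Fin n → 𝒳) (s : 𝒮)
    (g : (Fin n → 𝒵) → ℝ) :
    ∑ v : Fin n → 𝒴 × 𝒵, g (fun i => (v i).2) * ∏ i, W (x i) s (v i)
      = ∑ z, g z * ∏ i, margZ W s (x i) (z i) := by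
  rw [← (Equiv.arrowProdEquivProdArrow (Fin n) (fun _ => 𝒴) (fun _ => 𝒵)).symm.sum_comp,
    Fintype.sum_prod_type_right]
  refine Finset.sum_congr rfl fun z _ => ?_
  simp only [Equiv.arrowProdEquivProdArrow, Equiv.coe_fn_symm_mk, margZ]
  rw [← Finset.mul_sum, ← sum_pi_prod fun i y => W (x i) s (y, z i)]

lemma clProbEvent_twoPhase (W : 𝒳 → 𝒮 → 𝒴 × 𝒵 → ℝ) {m n : ℕ} (tr : Fin m → 𝒳)
    (c : (Fin m → 𝒵) → Fin n → 𝒳) (s : 𝒮) (A : (Fin (m + n) → 𝒴 × 𝒵) → Prop) :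
    clProbEvent W (twoPhase tr c) s A = ∑ u : Fin m → 𝒴 × 𝒵,
      (∑ v : Fin n → 𝒴 × 𝒵, ind (A (Fin.append u v)) * ∏ i, W (c (fun j => (u j).2) i) s (v i)) *
        ∏ i, W (tr i) s (u i) := by
  simp only [clProbEvent, ite_eq_ind_mul]
  rw [← (Fin.appendEquiv m n).sum_comp, Fintype.sum_prod_type]
  refine Finset.sum_congr rfl fun u _ => ?_
  rw [Finset.sum_mul]
  refine Finset.sum_congr rfl fun v _ => ?_
  simp only [Fin.appendEquiv, Equiv.coe_fn_mk, Fin.prod_univ_add, xReal_twoPhase_castAdd,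
    xReal_twoPhase_natAdd, Fin.append_left, Fin.append_right]
  ring

/-- The error event of a block decoder is at most the training error plus the worst block error for
a correctly estimated state. -/
lemma clProbEvent_twoPhase_le_add {W : 𝒳 → 𝒮 → 𝒴 × 𝒵 → ℝ} (hW : ∀ x s, IsPMF (W x s)) {m n : ℕ}
    (tr : Fin m → 𝒳) (est : (Fin m → 𝒵) → 𝒮) (x : 𝒮 → Fin n → 𝒳) (s : 𝒮)
    (B : (Fin n → 𝒴) → Prop) {ε₁ ε₂ : ℝ}
    (h₁ : ∑ z, ind (est z ≠ s) * ∏ i, margZ W s (tr i) (z i) ≤ ε₁)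
    (h₂ : ∑ y, ind (B y) * ∏ i, margY W s (x s i) (y i) ≤ ε₂) :
    clProbEvent W (twoPhase tr fun z => x (est z)) s
      (fun yz => B fun j => (yz (Fin.natAdd m j)).1) ≤ ε₁ + ε₂ := by
  rw [clProbEvent_twoPhase]
  have hT : IsPMF (fun u : Fin m → 𝒴 × 𝒵 => ∏ i, W (tr i) s (u i)) := IsPMF.pi fun i => hW (tr i) s
  have h0 : 0 ≤ ε₂ := le_trans (Finset.sum_nonneg fun y _ => mul_nonneg (ind_nonneg _)
    (Finset.prod_nonneg fun i _ => (isPMF_margY hW _ _).1 _)) h₂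
  rw [← sum_prod_eq_margZ W tr s fun z => ind (est z ≠ s)] at h₁
  calc _ ≤ ∑ u : Fin m → 𝒴 × 𝒵,
        (ind (est (fun j => (u j).2) ≠ s) + ε₂) * ∏ i, W (tr i) s (u i) := by
        refine Finset.sum_le_sum fun u _ => mul_le_mul_of_nonneg_right ?_ (hT.1 u)
        simp only [Fin.append_right]
        rw [sum_prod_eq_margY W _ s fun y => ind (B y)]
        by_cases hs : est (fun j => (u j).2) = s
        · rw [hs]
          exact h₂.trans (le_add_of_nonneg_left (ind_nonneg _))
        · rw [ind_of hs]
          refine le_add_of_le_of_nonneg ?_ h0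
          have hb : IsPMF fun y : Fin n → 𝒴 =>
              ∏ i, margY W s (x (est fun j => (u j).2) i) (y i) :=
            IsPMF.pi fun i => isPMF_margY hW s _
          rw [← hb.2]
          exact Finset.sum_le_sum fun y _ => mul_le_of_le_one_left (hb.1 y) (ind_le_one _)
    _ ≤ ε₁ + ε₂ := by
        simp_rw [add_mul]
        rw [Finset.sum_add_distrib, ← Finset.mul_sum, hT.2, mul_one]
        exact add_le_add_left h₁ _

lemma clProbEvent_twoPhase_le {W : 𝒳 → 𝒮 → 𝒴 × 𝒵 → ℝ} (hW : ∀ x s, IsPMF (W x s)) {m n : ℕ}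
    (tr : Fin m → 𝒳) (c : (Fin m → 𝒵) → Fin n → 𝒳) (s : 𝒮)
    (D : (Fin n → 𝒳) → (Fin n → 𝒵) → Prop) {ε : ℝ}
    (h : ∀ u, ∑ z, ind (D (c u) z) * ∏ i, margZ W s (c u i) (z i) ≤ ε) :
    clProbEvent W (twoPhase tr c) s (fun yz =>
      D (fun j => xReal (twoPhase tr c) yz (Fin.natAdd m j)) fun j => (yz (Fin.natAdd m j)).2)
      ≤ ε := by
  rw [clProbEvent_twoPhase]
  have hT : IsPMF (fun u : Fin m → 𝒴 × 𝒵 => ∏ i, W (tr i) s (u i)) := IsPMF.pi fun i => hW (tr i) s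
  refine le_of_le_of_eq (b := ∑ u : Fin m → 𝒴 × 𝒵, ε * ∏ i, W (tr i) s (u i))
    (Finset.sum_le_sum fun u _ => mul_le_mul_of_nonneg_right ?_ (hT.1 u))
    (by rw [← Finset.mul_sum, hT.2, mul_one])
  simp only [Fin.append_right, xReal_twoPhase_natAdd]
  rw [sum_prod_eq_margZ W _ s fun z => ind (D (c fun j => (u j).2) z)]
  exact h _

end TwoPhase

section Chernoff

variable {𝒳 𝒵 𝒮 : Type} [Fintype 𝒳] [Fintype 𝒵]

lemma phi_le_chernoffPair [Finite 𝒮] (V : 𝒮 → 𝒳 → 𝒵 → ℝ) (P : 𝒳 → ℝ) {s s' : 𝒮} (h : s ≠ s') :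
    phi V P ≤ chernoffPair P (V s) (V s') :=
  (ciInf_le (Set.finite_range _).bddBelow s).trans <|
    csInf_le ((Set.toFinite _).image _).bddBelow ⟨s', h.symm, rfl⟩

lemma exists_lt_of_lt_chernoffPair {P : 𝒳 → ℝ} {w w' : 𝒳 → 𝒵 → ℝ} {c : ℝ}
    (h : c < chernoffPair P w w') :
    ∃ ℓ ∈ Set.Icc (0 : ℝ) 1, c < -∑ x, P x * Real.log (chernoffSum (w x) (w' x) ℓ) := by
  obtain ⟨_, ⟨ℓ, hℓ, rfl⟩, hlt⟩ := exists_lt_of_lt_csSup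
    ((Set.nonempty_Icc.2 zero_le_one).image _) h
  exact ⟨ℓ, hℓ, hlt⟩

lemma StandingAssumption.exists_chernoffSum_lt_one [Nonempty 𝒳] {V : 𝒮 → 𝒳 → 𝒵 → ℝ}
    (h : StandingAssumption V) {s s' : 𝒮} (hs : s ≠ s') :
    ∃ ℓ ∈ Set.Icc (0 : ℝ) 1, ∃ x, chernoffSum (V s x) (V s' x) ℓ < 1 := by
  classical
  obtain ⟨x₀⟩ := ‹Nonempty 𝒳›
  have hne : {P : 𝒳 → ℝ | IsPMF P}.Nonempty :=
    ⟨Pi.single x₀ 1, fun x => by by_cases hx : x = x₀ <;> simp [hx], by simp⟩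
  obtain ⟨_, ⟨P, hP, rfl⟩, hpos⟩ := exists_lt_of_lt_csSup (hne.image _) (h s s' hs)
  obtain ⟨ℓ, hℓ, hlt⟩ := exists_lt_of_lt_chernoffPair hpos
  refine ⟨ℓ, hℓ, ?_⟩
  by_contra! hge
  have := Finset.sum_nonneg fun x (_ : x ∈ Finset.univ) =>
    mul_nonneg (hP.1 x) (Real.log_nonneg (hge x))
  linarith

end Chernoff

open Filter in
lemma closedLoopAchievable_of_le
    [Fintype 𝒳] [Fintype 𝒴] [Fintype 𝒵] [Fintype 𝒮] [Nonempty 𝒳] [Nonempty 𝒮]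
    (W : 𝒳 → 𝒮 → 𝒴 × 𝒵 → ℝ) (hW : ∀ x s, IsPMF (W x s))
    (hSA : StandingAssumption (margZ W))
    (Ptup : 𝒮 → 𝒳 → ℝ) (hP : ∀ s, IsPMF (Ptup s)) {R E : ℝ}
    (hR : ∀ s, R ≤ mutualInfo (Ptup s) (margY W s)) (hE : ∀ s, E ≤ phi (margZ W) (Ptup s)) :
    ClosedLoopAchievable W R E := by
  classical
  intro ε hε
  have hZ := isPMF_margZ hW
  have hℓ : ∀ s s₁ s₂ : 𝒮, ∃ ℓ ∈ Set.Icc (0 : ℝ) 1, s₁ ≠ s₂ → E - ε / 2 <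
      -∑ x, Ptup s x * Real.log (chernoffSum (margZ W s₁ x) (margZ W s₂ x) ℓ) :=
    fun s s₁ s₂ => by
      by_cases h : s₁ = s₂
      · exact ⟨0, by simp, fun hne => absurd h hne⟩
      obtain ⟨ℓ, hℓ, hlt⟩ := exists_lt_of_lt_chernoffPair
        (show E - ε / 2 < chernoffPair (Ptup s) (margZ W s₁) (margZ W s₂) by
          linarith [hE s, phi_le_chernoffPair (margZ W) (Ptup s) h])
      exact ⟨ℓ, hℓ, fun _ => hlt⟩
  choose ℓ hℓ hℓE using hℓ
  obtain ⟨m, tr, est, htr⟩ := exists_training hZ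
    (fun s s' h => hSA.exists_chernoffSum_lt_one h) (half_pos hε)
  have hcode := eventually_exists_codebook hP (isPMF_margY hW) (R := R - ε / 2)
    (fun _ s => by linarith [hR s])
    (κ := {q : 𝒮 × 𝒮 // q.1 ≠ q.2})
    (L := fun s q x => -Real.log
      (chernoffSum (margZ W q.1.1 x) (margZ W q.1.2 x) (ℓ s q.1.1 q.1.2)))
    (c := E - ε / 2)
    (fun s q => by simpa [Finset.sum_neg_distrib] using hℓE s q.1.1 q.1.2 q.2) (half_pos hε)
  have hlarge : ∀ a : ℝ, ∀ᶠ n : ℕ in atTop, a ≤ n * (ε / 2) := fun a =>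
    (tendsto_natCast_atTop_atTop.atTop_mul_const (half_pos hε)).eventually_ge_atTop a
  obtain ⟨n, ⟨M, x, h, hM, hrate, hx⟩, hnR, hnE, hn0⟩ :=
    (hcode.and ((hlarge (m * (R - ε))).and ((hlarge (Real.log (Fintype.card 𝒮) +
      m * (E - ε))).and (eventually_gt_atTop 0)))).exists
  obtain ⟨g, hg⟩ := exists_ml_estimator hZ n
  have hmn : (0 : ℝ) < m + n := by positivity
  refine ⟨m + n, M, fun w => twoPhase tr fun z => x w (est z),
    fun x z => g (fun j => x (Fin.natAdd m j)) fun j => z (Fin.natAdd m j),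
    fun y => h fun j => y (Fin.natAdd m j), by omega, hM, ?_, fun s w => ?_, fun s w => ?_⟩
  · push_cast
    rw [le_div_iff₀ hmn]
    linarith
  · rw [← add_halves ε]
    exact clProbEvent_twoPhase_le_add hW tr est (x w) s (fun y => h y ≠ w) (htr s) (hx w s).2
  · refine clProbEvent_twoPhase_le hW tr (fun z => x w (est z)) s (fun x z => g x z ≠ s)
      fun u => ?_
    have hcard : (0 : ℝ) < Fintype.card 𝒮 := by exact_mod_cast Fintype.card_pos
    calc _ ≤ ∑ s' ∈ Finset.univ.erase s, ∏ i, chernoffSum (margZ W s (x w (est u) i))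
          (margZ W s' (x w (est u) i)) (ℓ (est u) s s') := hg _ s _ fun s' => hℓ _ _ _
      _ ≤ ∑ s' ∈ Finset.univ.erase s, Real.exp (-(n * (E - ε / 2))) := by
          refine Finset.sum_le_sum fun s' hs' =>
            (prod_chernoffSum_le (hZ s) (hZ s') _ _).trans (Real.exp_le_exp.2 (neg_le_neg ?_))
          exact ((hx w (est u)).1 ⟨(s, s'), (Finset.mem_erase.1 hs').1.symm⟩).le
      _ ≤ ∑ s' : 𝒮, Real.exp (-(n * (E - ε / 2))) :=
          Finset.sum_le_sum_of_subset_of_nonneg (Finset.erase_subset _ _)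
            fun _ _ _ => (Real.exp_pos _).le
      _ = Real.exp (Real.log (Fintype.card 𝒮) + -(n * (E - ε / 2))) := by
          rw [Finset.sum_const, Finset.card_univ, nsmul_eq_mul, Real.exp_add, Real.exp_log hcard]
      _ ≤ _ := by
          refine Real.exp_le_exp.2 ?_
          push_cast
          linarith

/-- Theorem 2 of the paper: mono-static closed-loop inner bound. -/
theorem monoStatic_closedLoop_innerBound
    [Fintype 𝒳] [Fintype 𝒴] [Fintype 𝒵] [Fintype 𝒮] [Nonempty 𝒳] [Nonempty 𝒮]
    (W : 𝒳 → 𝒮 → 𝒴 × 𝒵 → ℝ) (hW : ∀ x s, IsPMF (W x s))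
    (hSA : StandingAssumption (margZ W))
    (Ptup : 𝒮 → 𝒳 → ℝ) (hP : ∀ s, IsPMF (Ptup s))
    (R E : ℝ) (hR0 : 0 ≤ R) (hE0 : 0 ≤ E)
    (hR : R ≤ ⨅ s, mutualInfo (Ptup s) (margY W s))
    (hE : E ≤ ⨅ s, phi (margZ W) (Ptup s)) :
    (R, E) ∈ closure {p : ℝ × ℝ | 0 ≤ p.1 ∧ 0 ≤ p.2 ∧ ClosedLoopAchievable W p.1 p.2} :=
  subset_closure ⟨hR0, hE0, closedLoopAchievable_of_le W hW hSA Ptup hP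
    (fun s => hR.trans (ciInf_le (Set.finite_range _).bddBelow s))
    (fun s => hE.trans (ciInf_le (Set.finite_range _).bddBelow s))⟩

end JCAS
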